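/- Let λ be a partition of n and T ∈ RSSYT(λ). Then I(T) = Inv(Min(T)) consists of exactly those ordered pairs of boxes (□_1, □_2) with □_1 <_T □_2, except the pairs with T(□_1) = T(□_2) for which □_1 lies to the left of □_2 in the same row of λ. -/

import Mathlib

open scoped Classical

/-- The content of a box `(i, j)` (row `i`, column `j`, both 0-indexed): `c(□) = j - i`. -/
def content (c : ℕ × ℕ) : ℤ := (c.2 : ℤ) - (c.1 : ℤ)

/-- The order on the formal labels `j·q^b` (encoded as pairs `(j, b)`):
`j·q^m < k·q^ℓ` iff `m > ℓ`, or `m = ℓ` and `j < k`. -/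
def labelLT (x y : ℕ × ℕ) : Prop := y.2 < x.2 ∨ (x.2 = y.2 ∧ x.1 < y.1)

/-- `τ` is a (non-negative) periodic standard Young tableau on the finite cell set `s`
(a labelling of the boxes by symbols `j·q^b`, encoded as pairs `(j, b)`): each number
`1 ≤ j ≤ s.card` occurs in exactly one box, the labels strictly increase along rows and
columns, and `τ` is normalized to `(0, 0)` off `s`. -/
def IsPSYT (s : Finset (ℕ × ℕ)) (τ : ℕ × ℕ → ℕ × ℕ) : Prop :=
  (∀ j, 1 ≤ j → j ≤ s.card → ∃! c, c ∈ s ∧ (τ c).1 = j) ∧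
  (∀ c ∈ s, ∀ c' ∈ s, c.1 = c'.1 → c.2 + 1 = c'.2 → labelLT (τ c) (τ c')) ∧
  (∀ c ∈ s, ∀ c' ∈ s, c.1 + 1 = c'.1 → c.2 = c'.2 → labelLT (τ c) (τ c')) ∧
  (∀ c, c ∉ s → τ c = (0, 0))

/-- `T` is a non-negative reverse Young tableau on `s`: entries weakly decrease along rows
and down columns (normalized to `0` off `s`). -/
def IsRYT (s : Finset (ℕ × ℕ)) (T : ℕ × ℕ → ℕ) : Prop :=
  (∀ c ∈ s, ∀ c' ∈ s, c.1 = c'.1 → c.2 + 1 = c'.2 → T c' ≤ T c) ∧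
  (∀ c ∈ s, ∀ c' ∈ s, c.1 + 1 = c'.1 → c.2 = c'.2 → T c' ≤ T c) ∧
  (∀ c, c ∉ s → T c = 0)

/-- `T` is a non-negative reverse semi-standard Young tableau on `s`: entries weakly
decrease along rows and strictly decrease down columns (normalized to `0` off `s`). -/
def IsRSSYT (s : Finset (ℕ × ℕ)) (T : ℕ × ℕ → ℕ) : Prop :=
  (∀ c ∈ s, ∀ c' ∈ s, c.1 = c'.1 → c.2 + 1 = c'.2 → T c' ≤ T c) ∧
  (∀ c ∈ s, ∀ c' ∈ s, c.1 + 1 = c'.1 → c.2 = c'.2 → T c' < T c) ∧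
  (∀ c, c ∉ s → T c = 0)

/-- `τ ∈ PSYT(λ; T)`: a periodic standard Young tableau whose `q`-exponents are given
by `T`. -/
def InFiber (s : Finset (ℕ × ℕ)) (T : ℕ × ℕ → ℕ) (τ : ℕ × ℕ → ℕ × ℕ) : Prop :=
  IsPSYT s τ ∧ ∀ c ∈ s, (τ c).2 = T c

/-- Column-standard reading order on boxes: columns left to right, each column top to
bottom. -/
def colReadLT (c c' : ℕ × ℕ) : Prop := c.2 < c'.2 ∨ (c.2 = c'.2 ∧ c.1 < c'.1)

/-- Row-standard reading order on boxes: rows top to bottom, left to right in each row. -/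
def rowReadLT (c c' : ℕ × ℕ) : Prop := c.1 < c'.1 ∨ (c.1 = c'.1 ∧ c.2 < c'.2)

/-- The box order `□ <_T □'`: `T □ > T □'`, or `T □ = T □'` and `□` precedes `□'` in the
column-standard reading order. -/
def boxLT (T : ℕ × ℕ → ℕ) (c c' : ℕ × ℕ) : Prop :=
  T c' < T c ∨ (T c = T c' ∧ colReadLT c c')

/-- The set `Inv(τ)` of inversion pairs of `τ` (with `q`-exponents `T`): ordered pairs of
boxes `(□₁, □₂)` with `□₁ <_T □₂` whose number labels are in decreasing order. -/
noncomputable def invSet (s : Finset (ℕ × ℕ)) (T : ℕ × ℕ → ℕ) (τ : ℕ × ℕ → ℕ × ℕ) :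
    Finset ((ℕ × ℕ) × (ℕ × ℕ)) :=
  (s ×ˢ s).filter fun p => boxLT T p.1 p.2 ∧ (τ p.2).1 < (τ p.1).1

/-- `inv(τ) = |Inv(τ)|`. -/
noncomputable def invNum (s : Finset (ℕ × ℕ)) (T : ℕ × ℕ → ℕ) (τ : ℕ × ℕ → ℕ × ℕ) : ℕ :=
  (invSet s T τ).card

/-- The auxiliary reading order used to define `Min(T)`: boxes with smaller `T`-value come
first, boxes of equal `T`-value in row-standard reading order. -/
def minOrd (T : ℕ × ℕ → ℕ) (c c' : ℕ × ℕ) : Prop :=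
  T c < T c' ∨ (T c = T c' ∧ rowReadLT c c')

/-- The tableau `Min(T) ∈ PSYT(λ;T)`: `q`-exponents given by `T`, numbers `1, …, n`
assigned so that boxes with larger `T`-value receive larger numbers, boxes of equal
`T`-value being numbered consecutively in row-standard reading order. -/
noncomputable def minTab (s : Finset (ℕ × ℕ)) (T : ℕ × ℕ → ℕ) : ℕ × ℕ → ℕ × ℕ :=
  fun c => if c ∈ s then ((s.filter fun c' => minOrd T c' c).card + 1, T c) else (0, 0)

theorem minOrd_irrefl (T : ℕ × ℕ → ℕ) (c : ℕ × ℕ) : ¬ minOrd T c c := by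
  simp [minOrd, rowReadLT]

theorem minOrd_trans {T : ℕ × ℕ → ℕ} {a b c : ℕ × ℕ} (hab : minOrd T a b)
    (hbc : minOrd T b c) : minOrd T a c := by
  unfold minOrd rowReadLT at *
  omega

theorem minTab_fst_lt {s : Finset (ℕ × ℕ)} {T : ℕ × ℕ → ℕ} {c d : ℕ × ℕ} (hc : c ∈ s)
    (hd : d ∈ s) (h : minOrd T c d) : (minTab s T c).1 < (minTab s T d).1 := by
  simp only [minTab, hc, hd, if_true, Nat.add_lt_add_iff_right]
  refine Finset.card_lt_card (Finset.ssubset_iff_of_subset ?_ |>.2 ⟨c, ?_, ?_⟩)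
  · intro x hx
    rw [Finset.mem_filter] at hx ⊢
    exact ⟨hx.1, minOrd_trans hx.2 h⟩
  · exact Finset.mem_filter.2 ⟨hc, h⟩
  · exact fun hx => minOrd_irrefl T c (Finset.mem_filter.1 hx).2

/-- The numbers of `Min(T)` are ordered by `minOrd`. -/
theorem minTab_fst_lt_iff {s : Finset (ℕ × ℕ)} {T : ℕ × ℕ → ℕ} {c d : ℕ × ℕ} (hc : c ∈ s)
    (hd : d ∈ s) : (minTab s T c).1 < (minTab s T d).1 ↔ minOrd T c d := by
  refine ⟨fun h => ?_, minTab_fst_lt hc hd⟩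
  by_contra hcd
  by_cases heq : c = d
  · exact h.ne (by rw [heq])
  · have hdc : minOrd T d c := by
      rw [Prod.ext_iff] at heq
      unfold minOrd rowReadLT at *
      omega
    exact h.asymm (minTab_fst_lt hd hc hdc)

theorem IsRSSYT.row_le {μ : YoungDiagram} {T : ℕ × ℕ → ℕ} (hT : IsRSSYT μ.cells T)
    {i j k : ℕ} (hjk : j ≤ k) (h : (i, k) ∈ μ) : T (i, k) ≤ T (i, j) := by
  induction k, hjk using Nat.le_induction with
  | base => exact le_rfl
  | succ k _ ih =>
    have hk : (i, k) ∈ μ := μ.up_left_mem le_rfl (Nat.le_succ k) h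
    exact (hT.1 (i, k) hk (i, k + 1) h rfl rfl).trans (ih hk)

theorem IsRSSYT.col_lt {μ : YoungDiagram} {T : ℕ × ℕ → ℕ} (hT : IsRSSYT μ.cells T)
    {i j k : ℕ} (hij : i < j) (h : (j, k) ∈ μ) : T (j, k) < T (i, k) := by
  induction j, Nat.succ_le_of_lt hij using Nat.le_induction with
  | base => exact hT.2.1 (i, k) (μ.up_left_mem (Nat.le_succ i) le_rfl h) (i + 1, k) h rfl rfl
  | succ j hj ih =>
    have hk : (j, k) ∈ μ := μ.up_left_mem (Nat.le_succ j) le_rfl h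
    exact (hT.2.1 (j, k) hk (j + 1, k) h rfl rfl).trans (ih hj hk)

/-- Let `λ` be a partition of `n` and `T ∈ RSSYT(λ)`. Then
`I(T) = Inv(Min(T))` consists of exactly those ordered pairs of boxes `(□₁, □₂)` with
`□₁ <_T □₂`, except the pairs with `T □₁ = T □₂` for which `□₁` lies to the left of `□₂`
in the same row of `λ`. -/
theorem statement16 (μ : YoungDiagram) (n : ℕ) (hn : μ.card = n)
    (T : ℕ × ℕ → ℕ) (hT : IsRSSYT μ.cells T) :
    invSet μ.cells T (minTab μ.cells T) =
      (μ.cells ×ˢ μ.cells).filter fun p =>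
        boxLT T p.1 p.2 ∧ ¬(T p.1 = T p.2 ∧ p.1.1 = p.2.1 ∧ p.1.2 < p.2.2) := by
  ext ⟨⟨a, b⟩, ⟨c, d⟩⟩
  simp only [invSet, Finset.mem_filter, Finset.mem_product]
  refine and_congr_right fun ⟨hab, hcd⟩ => and_congr_right fun hlt => ?_
  rw [minTab_fst_lt_iff hcd hab]
  have key : a < c → b ≤ d → T (c, d) < T (a, b) := fun hac hbd =>
    (hT.row_le hbd hcd).trans_lt (hT.col_lt hac (μ.up_left_mem le_rfl hbd hcd))
  simp only [boxLT, colReadLT, minOrd, rowReadLT] at hlt ⊢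
  omega
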